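/- Let G be a strictly chordal graph with at least two distinct minimal vertex separators. Then there exists a minimal vertex separator S of G such that the number of boundary cliques of G containing S equals μ(S), i.e., equals ω(G−S) − 1. -/

import Mathlib

open SimpleGraph

variable {V : Type*}

noncomputable def numComp (G : SimpleGraph V) (S : Set V) : ℕ :=
  Nat.card (G.induce Sᶜ).ConnectedComponent

def SeparatedBy (G : SimpleGraph V) (S : Set V) (u v : V) : Prop :=
  ∃ (hu : u ∈ Sᶜ) (hv : v ∈ Sᶜ), ¬ (G.induce Sᶜ).Reachable ⟨u, hu⟩ ⟨v, hv⟩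

def IsSeparator (G : SimpleGraph V) (S : Set V) : Prop :=
  ∃ u v, G.Reachable u v ∧ SeparatedBy G S u v

def IsMinimalSeparator (G : SimpleGraph V) (S : Set V) : Prop :=
  IsSeparator G S ∧ ∀ T ⊂ S, ¬ IsSeparator G T

def IsMVS (G : SimpleGraph V) (S : Set V) : Prop :=
  ∃ u v, u ≠ v ∧ ¬ G.Adj u v ∧ SeparatedBy G S u v ∧ ∀ T ⊂ S, ¬ SeparatedBy G T u v

def IsChordal (G : SimpleGraph V) : Prop :=
  ∀ n, 4 ≤ n → IsEmpty (cycleGraph n ↪g G)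

def StrictlyChordal (G : SimpleGraph V) : Prop :=
  G.Connected ∧ IsChordal G ∧
    ∀ S S' : Set V, IsMVS G S → IsMVS G S' → S ≠ S' → Disjoint S S'

noncomputable def sc [Finite V] (G : SimpleGraph V) : ℤ :=
  sSup {k : ℤ | ∃ S : Set V, numComp G S ≠ 1 ∧ k = (numComp G S : ℤ) - (Nat.card S : ℤ)}

noncomputable def toughness [Finite V] (G : SimpleGraph V) : ℝ :=
  sInf {t : ℝ | ∃ S : Set V, 1 < numComp G S ∧ t = (Nat.card S : ℝ) / (numComp G S : ℝ)}

def IsScatteringSet [Finite V] (G : SimpleGraph V) (S : Set V) : Prop :=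
  numComp G S ≠ 1 ∧ (numComp G S : ℤ) - (Nat.card S : ℤ) = sc G

def IsMaxClique (G : SimpleGraph V) (Q : Set V) : Prop :=
  G.IsClique Q ∧ ∀ R : Set V, G.IsClique R → Q ⊆ R → Q = R

def IsSimplicial (G : SimpleGraph V) (v : V) : Prop :=
  G.IsClique (G.neighborSet v)

def IsBoundaryClique (G : SimpleGraph V) (Q : Set V) : Prop :=
  IsMaxClique G Q ∧ (∃ v ∈ Q, IsSimplicial G v) ∧
    ∃ Q' : Set V, IsMaxClique G Q' ∧ Q' ≠ Q ∧ Q ∩ Q' = {v | v ∈ Q ∧ ¬ IsSimplicial G v}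

def BS (G : SimpleGraph V) (S : Set V) : Set (Set V) :=
  {Q | IsBoundaryClique G Q ∧ S ⊆ Q}

/-- `u` and `v` lie in the same connected component of `G - S`. -/
def Linked (G : SimpleGraph V) (S : Set V) (u v : V) : Prop :=
  ∃ (hu : u ∈ Sᶜ) (hv : v ∈ Sᶜ), (G.induce Sᶜ).Reachable ⟨u, hu⟩ ⟨v, hv⟩

namespace Linked

variable {G : SimpleGraph V} {S : Set V} {u v w : V}

theorem refl (hu : u ∉ S) : Linked G S u u := ⟨hu, hu, Reachable.refl _⟩

theorem symm (h : Linked G S u v) : Linked G S v u :=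
  let ⟨hu, hv, h⟩ := h
  ⟨hv, hu, h.symm⟩

theorem trans (h : Linked G S u v) (h' : Linked G S v w) : Linked G S u w :=
  let ⟨hu, _, h⟩ := h
  let ⟨_, hw, h'⟩ := h'
  ⟨hu, hw, h.trans h'⟩

theorem left_notMem (h : Linked G S u v) : u ∉ S := h.1

theorem right_notMem (h : Linked G S u v) : v ∉ S := h.2.1

theorem of_adj (hu : u ∉ S) (hv : v ∉ S) (h : G.Adj u v) : Linked G S u v :=
  ⟨hu, hv, Adj.reachable (by simpa using h)⟩

theorem tail (h : Linked G S u v) (hw : w ∉ S) (hvw : G.Adj v w) : Linked G S u w :=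
  h.trans (of_adj h.right_notMem hw hvw)

theorem of_isClique {Q : Set V} (hQ : G.IsClique Q) (hu : u ∈ Q) (hv : v ∈ Q) (huS : u ∉ S)
    (hvS : v ∉ S) : Linked G S u v := by
  by_cases h : u = v
  · exact h ▸ refl huS
  · exact of_adj huS hvS (hQ hu hv h)

theorem induct (h : Linked G S u v) {P : V → Prop} (base : P u)
    (step : ∀ x y, Linked G S u x → P x → G.Adj x y → y ∉ S → P y) : P v := by
  obtain ⟨hu, hv, ⟨p⟩⟩ := h
  have key : ∀ (a b : (Sᶜ : Set V)), (G.induce Sᶜ).Walk a b → Linked G S u a → P a → P b := by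
    intro a b p
    induction p with
    | nil => exact fun _ h => h
    | @cons a c b hac _ ih =>
      intro hl ha
      have hac' : G.Adj a c := by simpa using hac
      exact ih (hl.tail c.2 hac') (step _ _ hl ha hac' c.2)
  exact key _ _ p (refl hu) base

end Linked

theorem separatedBy_iff {G : SimpleGraph V} {S : Set V} {u v : V} :
    SeparatedBy G S u v ↔ u ∉ S ∧ v ∉ S ∧ ¬ Linked G S u v := by
  constructor
  · rintro ⟨hu, hv, h⟩
    exact ⟨hu, hv, fun ⟨_, _, h'⟩ => h h'⟩
  · rintro ⟨hu, hv, h⟩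
    exact ⟨hu, hv, fun h' => h ⟨hu, hv, h'⟩⟩

theorem SeparatedBy.symm {G : SimpleGraph V} {S : Set V} {u v : V} (h : SeparatedBy G S u v) :
    SeparatedBy G S v u :=
  let ⟨hu, hv, h⟩ := h
  ⟨hv, hu, fun h' => h h'.symm⟩

theorem SeparatedBy.mem_of_adj_adj {G : SimpleGraph V} {S : Set V} {u v w : V}
    (h : SeparatedBy G S u v) (huw : G.Adj u w) (hvw : G.Adj v w) : w ∈ S := by
  rw [separatedBy_iff] at h
  by_contra hw
  exact h.2.2 ((Linked.of_adj h.1 hw huw).tail h.2.1 hvw.symm)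

/-- A shortest path of `G - S`, given by its sequence of vertices. -/
theorem Linked.exists_inducedPath {G : SimpleGraph V} {S : Set V} {u v : V}
    (h : Linked G S u v) :
    ∃ (m : ℕ) (p : ℕ → V), p 0 = u ∧ p m = v ∧ (∀ i, p i ∉ S) ∧
      (∀ i j, i ≤ m → j ≤ m → p i = p j → i = j) ∧
      (∀ i j, i ≤ m → j ≤ m → (G.Adj (p i) (p j) ↔ i + 1 = j ∨ j + 1 = i)) := by
  obtain ⟨hu, hv, h⟩ := h
  set H := G.induce Sᶜ with hH
  obtain ⟨p, hp⟩ := h.exists_walk_length_eq_dist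
  have hd : ∀ i ≤ p.length, H.dist ⟨u, hu⟩ (p.getVert i) = i := by
    intro i hi
    have h1 := dist_le (p.take i)
    have h2 := dist_le (p.drop i)
    have h3 := (p.take i).reachable.dist_triangle_left ⟨v, hv⟩
    rw [Walk.take_length] at h1
    rw [Walk.drop_length] at h2
    omega
  refine ⟨p.length, fun i => (p.getVert i : V), by simp, by simp, fun i => (p.getVert i).2,
    fun i j hi hj hij => ?_, fun i j hi hj => ⟨fun hij => ?_, ?_⟩⟩
  · have := hd i hi
    rw [Subtype.ext hij, hd j hj] at this
    exact this.symm
  · have hij' : H.Adj (p.getVert i) (p.getVert j) := by simpa [hH] using hij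
    have h1 := (p.take i).reachable.dist_triangle_left (p.getVert j)
    have h2 := (p.take j).reachable.dist_triangle_left (p.getVert i)
    have h3 := dist_eq_one_iff_adj.2 hij'
    have h4 := dist_eq_one_iff_adj.2 hij'.symm
    have h5 : i ≠ j := by
      rintro rfl
      exact hij.ne rfl
    rw [hd i hi, hd j hj] at h1 h2
    omega
  · rintro (rfl | rfl)
    · simpa [hH] using p.adj_getVert_succ (i := i) (by omega)
    · simpa [hH] using (p.adj_getVert_succ (i := j) (by omega)).symm

theorem IsChordal.false_of_two_paths {G : SimpleGraph V} (hG : IsChordal G) {m n : ℕ}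
    (hm : 2 ≤ m) (hn : 2 ≤ n) {p q : ℕ → V} (h0 : p 0 = q 0) (h1 : p m = q n)
    (pinj : ∀ i j, i ≤ m → j ≤ m → p i = p j → i = j)
    (padj : ∀ i j, i ≤ m → j ≤ m → (G.Adj (p i) (p j) ↔ i + 1 = j ∨ j + 1 = i))
    (qinj : ∀ i j, i ≤ n → j ≤ n → q i = q j → i = j)
    (qadj : ∀ i j, i ≤ n → j ≤ n → (G.Adj (q i) (q j) ↔ i + 1 = j ∨ j + 1 = i))
    (hne : ∀ i j, 0 < i → i < m → 0 < j → j < n → p i ≠ q j ∧ ¬ G.Adj (p i) (q j)) : False := by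
  have hpq : ∀ i j, i ≤ m → 0 < j → j < n →
      p i ≠ q j ∧ (G.Adj (p i) (q j) ↔ i = 0 ∧ j = 1 ∨ i = m ∧ j + 1 = n) := by
    intro i j hi hj hj'
    rcases Nat.eq_zero_or_pos i with rfl | hi0
    · rw [h0, qadj _ _ (by omega) (by omega)]
      exact ⟨fun h => by have := qinj _ _ (by omega) (by omega) h; omega, by omega⟩
    rcases hi.eq_or_lt with rfl | him
    · rw [h1, qadj _ _ (by omega) (by omega)]
      exact ⟨fun h => by have := qinj _ _ (by omega) (by omega) h; omega, by omega⟩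
    · have := hne i j hi0 him hj hj'
      exact ⟨this.1, fun h => absurd h this.2, by omega⟩
  let f : Fin (m + n) → V := fun i => if (i : ℕ) ≤ m then p i else q (m + n - i)
  have finj : Function.Injective f := by
    intro i j hij
    have hi := i.2
    have hj := j.2
    apply Fin.ext
    simp only [f] at hij
    split_ifs at hij with ha hb hb
    · exact pinj _ _ ha hb hij
    · exact absurd hij (hpq _ _ ha (by omega) (by omega)).1
    · exact absurd hij.symm (hpq _ _ hb (by omega) (by omega)).1
    · have := qinj _ _ (by omega) (by omega) hij
      omega
  refine (hG (m + n) (by omega)).false ⟨⟨f, finj⟩, ?_⟩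
  intro i j
  have hi := i.2
  have hj := j.2
  have hsub : ∀ a b : Fin (m + n), (a - b).val = 1 ↔
      b.val + 1 = a.val ∨ a.val = 0 ∧ b.val + 1 = m + n := by
    intro a b
    have ha := a.2
    have hb := b.2
    rcases le_or_gt b a with hab | hab
    · rw [Fin.sub_val_of_le hab]
      have : b.val ≤ a.val := hab
      omega
    · rw [Fin.coe_sub_iff_lt.2 hab]
      have : a.val < b.val := hab
      omega
  rw [cycleGraph_adj', hsub, hsub]
  simp only [f, Function.Embedding.coeFn_mk]
  split_ifs with ha hb hb
  · rw [padj _ _ ha hb]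
    omega
  · rw [(hpq _ _ ha (by omega) (by omega)).2]
    omega
  · rw [G.adj_comm, (hpq _ _ hb (by omega) (by omega)).2]
    omega
  · rw [qadj _ _ (by omega) (by omega)]
    omega

section

variable {G : SimpleGraph V} {S : Set V} {u v s x y : V}

/-- Every vertex of a minimal `u`-`v` separator has a neighbor in the component of `u`. -/
theorem exists_linked_adj_of_minimal (hsep : SeparatedBy G S u v)
    (hmin : ∀ T ⊂ S, ¬ SeparatedBy G T u v) (hs : s ∈ S) :
    ∃ w, Linked G S u w ∧ G.Adj w s := by
  rw [separatedBy_iff] at hsep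
  by_contra! hcon
  have hT := hmin (S \ {s}) ⟨Set.sdiff_subset, fun h => (h hs).2 rfl⟩
  rw [separatedBy_iff] at hT
  have hl : Linked G (S \ {s}) u v := by
    by_contra hl
    exact hT ⟨fun h => hsep.1 h.1, fun h => hsep.2.1 h.1, hl⟩
  refine hsep.2.2 (hl.induct (Linked.refl hsep.1) fun x y _ hx hxy hy => ?_)
  refine hx.tail (fun hyS => hy ⟨hyS, ?_⟩) hxy
  rintro rfl
  exact hcon x hx hxy

theorem exists_inducedPath_through {a : V}
    (hx : ∃ w, Linked G S a w ∧ G.Adj w x) (hy : ∃ w, Linked G S a w ∧ G.Adj w y) :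
    ∃ (m : ℕ) (p : ℕ → V), p 0 = x ∧ p m = y ∧
      (∀ i, Linked G S a (p i) ∨ p i = x ∨ p i = y) ∧
      (∀ i j, i ≤ m → j ≤ m → p i = p j → i = j) ∧
      (∀ i j, i ≤ m → j ≤ m → (G.Adj (p i) (p j) ↔ i + 1 = j ∨ j + 1 = i)) := by
  obtain ⟨w, hw, hwx⟩ := hx
  obtain ⟨z, hz, hzy⟩ := hy
  let T : Set V := {t | Linked G S a t ∨ t = x ∨ t = y}ᶜ
  have hT : ∀ t, Linked G S a t ∨ t = x ∨ t = y → t ∉ T := fun t ht h => h ht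
  have hA : ∀ t, Linked G S a t → Linked G T a t := fun t ht =>
    ht.induct (Linked.refl (hT _ (Or.inl (Linked.refl ht.left_notMem))))
      fun b c hb hb' hbc hc => hb'.tail (hT _ (Or.inl (hb.tail hc hbc))) hbc
  have hxy : Linked G T x y :=
    ((hA w hw).tail (hT _ (by simp)) hwx).symm.trans ((hA z hz).tail (hT _ (by simp)) hzy)
  obtain ⟨m, p, h0, hm, hp, h⟩ := hxy.exists_inducedPath
  exact ⟨m, p, h0, hm, fun i => not_not.1 (hp i), h⟩

/-- Dirac: minimal vertex separators of chordal graphs are cliques. -/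
theorem IsMVS.isClique (hG : IsChordal G) (hS : IsMVS G S) : G.IsClique S := by
  obtain ⟨u, v, -, -, hsep, hmin⟩ := hS
  have hmin' : ∀ T ⊂ S, ¬ SeparatedBy G T v u := fun T hT h => hmin T hT h.symm
  have hsep' := separatedBy_iff.1 hsep
  intro x hx y hy hne
  by_contra hadj
  obtain ⟨m, p, p0, pm, hp, pinj, padj⟩ := exists_inducedPath_through
    (exists_linked_adj_of_minimal hsep hmin hx) (exists_linked_adj_of_minimal hsep hmin hy)
  obtain ⟨n, q, q0, qn, hq, qinj, qadj⟩ := exists_inducedPath_through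
    (exists_linked_adj_of_minimal hsep.symm hmin' hx)
    (exists_linked_adj_of_minimal hsep.symm hmin' hy)
  have two_le : ∀ (k : ℕ) (r : ℕ → V), r 0 = x → r k = y →
      (∀ i j, i ≤ k → j ≤ k → (G.Adj (r i) (r j) ↔ i + 1 = j ∨ j + 1 = i)) → 2 ≤ k := by
    intro k r r0 rk radj
    by_contra hk
    obtain rfl | rfl : k = 0 ∨ k = 1 := by omega
    · exact hne (r0.symm.trans rk)
    · have := (radj 0 1 (by omega) le_rfl).2 (by omega)
      rw [r0, rk] at this
      exact hadj this
  have hm := two_le m p p0 pm padj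
  have hn := two_le n q q0 qn qadj
  refine hG.false_of_two_paths hm hn (p0.trans q0.symm) (pm.trans qn.symm) pinj padj qinj qadj ?_
  intro i j hi him hj hjn
  have hpi : Linked G S u (p i) := by
    rcases hp i with h | h | h
    · exact h
    · have := pinj i 0 (by omega) (by omega) (h.trans p0.symm)
      omega
    · have := pinj i m (by omega) (by omega) (h.trans pm.symm)
      omega
  have hqj : Linked G S v (q j) := by
    rcases hq j with h | h | h
    · exact h
    · have := qinj j 0 (by omega) (by omega) (h.trans q0.symm)
      omega
    · have := qinj j n (by omega) (by omega) (h.trans qn.symm)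
      omega
  refine ⟨fun h => hsep'.2.2 (hpi.trans (h ▸ hqj.symm)), fun h => hsep'.2.2 ?_⟩
  exact (hpi.tail hqj.right_notMem h).trans hqj.symm

theorem IsMVS.not_isSimplicial (hS : IsMVS G S) (hs : s ∈ S) : ¬ IsSimplicial G s := by
  obtain ⟨u, v, -, -, hsep, hmin⟩ := hS
  obtain ⟨w, hw, hws⟩ := exists_linked_adj_of_minimal hsep hmin hs
  obtain ⟨z, hz, hzs⟩ := exists_linked_adj_of_minimal hsep.symm
    (fun T hT h => hmin T hT h.symm) hs
  intro hsimp
  refine (separatedBy_iff.1 hsep).2.2 ((hw.trans ?_).trans hz.symm)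
  exact Linked.of_isClique hsimp hws.symm hzs.symm hw.right_notMem hz.right_notMem

theorem IsMVS.nonempty (hG : G.Connected) (hS : IsMVS G S) : S.Nonempty := by
  obtain ⟨u, v, -, -, hsep, hmin⟩ := hS
  rw [Set.nonempty_iff_ne_empty]
  rintro rfl
  refine (separatedBy_iff.1 hsep).2.2 ?_
  obtain ⟨p⟩ := hG.preconnected u v
  clear hsep hmin
  induction p with
  | nil => exact Linked.refl (by simp)
  | cons h _ ih => exact (Linked.of_adj (by simp) (by simp) h).trans ih

theorem exists_isMVS_of_not_adj [Finite V] (hne : u ≠ v) (hadj : ¬ G.Adj u v) :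
    ∃ T, IsMVS G T ∧ SeparatedBy G T u v := by
  have h0 : SeparatedBy G {u, v}ᶜ u v := by
    rw [separatedBy_iff]
    refine ⟨by simp, by simp, fun h => hne ?_⟩
    refine (h.induct (P := fun w => w = u) rfl ?_).symm
    rintro x y - rfl hxy hy
    rcases not_not.1 hy with rfl | rfl
    · rfl
    · exact absurd hxy hadj
  obtain ⟨T, -, hT⟩ :=
    exists_minimal_le_of_wellFoundedLT (fun T => SeparatedBy G T u v) _ h0
  exact ⟨T, ⟨u, v, hne, hadj, hT.prop, fun R hR hsep => hR.2 (hT.le_of_le hsep hR.1)⟩, hT.prop⟩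

theorem exists_isMVS_of_not_isSimplicial [Finite V] (h : ¬ IsSimplicial G s) :
    ∃ T, IsMVS G T ∧ s ∈ T := by
  have h' : ∃ x ∈ G.neighborSet s, ∃ y ∈ G.neighborSet s, x ≠ y ∧ ¬ G.Adj x y := by
    by_contra! hcon
    exact h fun x hx y hy hxy => hcon x hx y hy hxy
  obtain ⟨x, hx, y, hy, hxy, hadj⟩ := h'
  obtain ⟨T, hT, hsep⟩ := exists_isMVS_of_not_adj hxy hadj
  exact ⟨T, hT, hsep.mem_of_adj_adj (Adj.symm hx) (Adj.symm hy)⟩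

theorem IsSimplicial.isMaxClique (hx : IsSimplicial G x) :
    IsMaxClique G (insert x (G.neighborSet x)) := by
  refine ⟨hx.insert fun y hy _ => hy, fun R hR hsub => hsub.antisymm fun y hy => ?_⟩
  by_cases hxy : x = y
  · exact Or.inl hxy.symm
  · exact Or.inr (hR (hsub (Or.inl rfl)) hy hxy)

theorem IsMaxClique.eq_insert_neighborSet {Q : Set V} (hQ : IsMaxClique G Q) (hxQ : x ∈ Q)
    (hx : IsSimplicial G x) : Q = insert x (G.neighborSet x) := by
  refine hQ.2 _ hx.isMaxClique.1 fun y hy => ?_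
  by_cases hxy : x = y
  · exact Or.inl hxy.symm
  · exact Or.inr (hQ.1 hxQ hy hxy)

theorem exists_isMaxClique_ge [Finite V] {R : Set V} (hR : G.IsClique R) :
    ∃ Q, R ⊆ Q ∧ IsMaxClique G Q := by
  obtain ⟨Q, hRQ, hQ⟩ := exists_maximal_ge_of_wellFoundedGT (fun Q => G.IsClique Q) _ hR
  exact ⟨Q, hRQ, hQ.prop, fun R hR h => h.antisymm (hQ.le_of_ge hR h)⟩

namespace StrictlyChordal

theorem isClique (hG : StrictlyChordal G) (hS : IsMVS G S) : G.IsClique S :=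
  hS.isClique hG.2.1

theorem eq_of_mem {T : Set V} (hG : StrictlyChordal G) (hS : IsMVS G S) (hT : IsMVS G T)
    (hs : s ∈ S) (hs' : s ∈ T) : S = T := by
  by_contra hne
  exact Set.disjoint_left.1 (hG.2.2 S T hS hT hne) hs hs'

theorem adj_of_adj [Finite V] {t : V} (hG : StrictlyChordal G) (hS : IsMVS G S)
    (hx : x ∉ S) (hs : s ∈ S) (ht : t ∈ S) (hxs : G.Adj x s) : G.Adj x t := by
  by_contra hxt
  have hne : x ≠ t := fun h => hx (h ▸ ht)
  obtain ⟨T, hT, hsep⟩ := exists_isMVS_of_not_adj hne hxt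
  have hts : G.Adj t s := hG.isClique hS ht hs fun h => hxt (h ▸ hxs)
  have hST := hG.eq_of_mem hS hT hs (hsep.mem_of_adj_adj hxs hts)
  exact (separatedBy_iff.1 hsep).2.1 (hST ▸ ht)

/-- Every component of `G - S` contains a vertex that is complete to `S`. -/
theorem exists_linked_complete [Finite V] (hG : StrictlyChordal G) (hS : IsMVS G S)
    (hx : x ∉ S) : ∃ k, Linked G S x k ∧ ∀ s ∈ S, G.Adj k s := by
  obtain ⟨s, hs⟩ := hS.nonempty hG.1
  have key : ∃ k, Linked G S x k ∧ ∃ t ∈ S, G.Adj k t := by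
    by_contra! hcon
    have : ∀ a b, G.Walk a b → Linked G S x a → Linked G S x b := by
      intro a b p
      induction p with
      | nil => exact id
      | @cons a c _ hac _ ih => exact fun ha => ih (ha.tail (fun hc => hcon a ha c hc hac) hac)
    obtain ⟨p⟩ := hG.1.preconnected x s
    exact (this _ _ p (Linked.refl hx)).right_notMem hs
  obtain ⟨k, hk, t, ht, hkt⟩ := key
  exact ⟨k, hk, fun r hr => hG.adj_of_adj hS hk.right_notMem ht hr hkt⟩

/-- Some minimal vertex separator `S` has all the other ones in a single component of `G - S`. -/
theorem exists_leaf [Finite V] (hG : StrictlyChordal G)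
    (h2 : ∃ S S' : Set V, IsMVS G S ∧ IsMVS G S' ∧ S ≠ S') :
    ∃ S a S', IsMVS G S ∧ IsMVS G S' ∧ S ≠ S' ∧ a ∉ S ∧
      ∀ T, IsMVS G T → T ≠ S → ∀ x ∈ T, Linked G S a x := by
  let C : Set (Set V × V) :=
    {c | IsMVS G c.1 ∧ c.2 ∉ c.1 ∧ ∃ S', IsMVS G S' ∧ c.1 ≠ S' ∧ ∀ x ∈ S', Linked G c.1 c.2 x}
  have hC : C.Nonempty := by
    obtain ⟨S, S', hS, hS', hne⟩ := h2
    obtain ⟨a, ha⟩ := hS'.nonempty hG.1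
    have hdis : ∀ x ∈ S', x ∉ S := fun x hx hxS => hne (hG.eq_of_mem hS hS' hxS hx)
    exact ⟨(S, a), hS, hdis a ha, S', hS', hne, fun x hx =>
      Linked.of_isClique (hG.isClique hS') ha hx (hdis a ha) (hdis x hx)⟩
  obtain ⟨⟨S, a⟩, ⟨hS, ha, S', hS', hne, -⟩, hmax⟩ :=
    Set.exists_max_image C (fun c => {w | Linked G c.1 c.2 w}.ncard) C.toFinite hC
  refine ⟨S, a, S', hS, hS', hne, ha, fun T hT hTS x hx => ?_⟩
  by_contra hax
  have hdis : ∀ y ∈ T, y ∉ S := fun y hy hyS => hTS (hG.eq_of_mem hT hS hy hyS)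
  have hTa : ∀ y, Linked G S a y → y ∉ T := fun y hy hyT => hax <|
    hy.trans (Linked.of_isClique (hG.isClique hT) hyT hx (hdis y hyT) (hdis x hx))
  have hsub : ∀ y, Linked G S a y → Linked G T a y := fun y hy =>
    hy.induct (Linked.refl (hTa a (Linked.refl ha)))
      fun b c hb hb' hbc hc => hb'.tail (hTa c (hb.tail hc hbc)) hbc
  obtain ⟨k, hk, hkS⟩ := hG.exists_linked_complete hS ha
  have hST : ∀ s ∈ S, Linked G T a s := fun s hs =>
    (hsub k hk).tail (fun h => hdis s h hs) (hkS s hs)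
  have hle := hmax (T, a) ⟨hT, hTa a (Linked.refl ha), S, hS, hTS, hST⟩
  refine absurd hle (not_le.2 (Set.ncard_lt_ncard ?_ (Set.toFinite _)))
  obtain ⟨s, hs⟩ := hS.nonempty hG.1
  exact ⟨hsub, fun h => (h (hST s hs)).right_notMem hs⟩

/-- A component of `G - S` that meets no minimal vertex separator forms a boundary clique
together with `S`. -/
theorem isBoundaryClique_union [Finite V] (hG : StrictlyChordal G) (hS : IsMVS G S) {a : V}
    (ha : a ∉ S) (hT : ∀ T, IsMVS G T → T ≠ S → ∀ x ∈ T, Linked G S a x)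
    (hx : x ∉ S) (hax : ¬ Linked G S a x) :
    IsBoundaryClique G (S ∪ {y | Linked G S x y}) := by
  have hsimp : ∀ y, Linked G S x y → IsSimplicial G y := by
    intro y hy
    by_contra hns
    obtain ⟨T, hTm, hyT⟩ := exists_isMVS_of_not_isSimplicial hns
    by_cases hTS : T = S
    · exact hy.right_notMem (hTS ▸ hyT)
    · exact hax ((hT T hTm hTS y hyT).trans hy.symm)
  have hxx : Linked G S x x := Linked.refl hx
  have hcomp : ∀ y, Linked G S x y → y = x ∨ G.Adj x y := by
    intro y hy
    refine hy.induct (P := fun y => y = x ∨ G.Adj x y) (Or.inl rfl) fun b c hb hb' hbc hc => ?_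
    rcases hb' with rfl | hxb
    · exact Or.inr hbc
    · by_cases hxc : x = c
      · exact Or.inl hxc.symm
      · exact Or.inr (hsimp b hb hxb.symm hbc hxc)
  have hxS : ∀ s ∈ S, G.Adj x s := by
    obtain ⟨k, hk, hkS⟩ := hG.exists_linked_complete hS hx
    intro s hs
    rcases hcomp k hk with rfl | hxk
    · exact hkS s hs
    · exact hsimp k hk hxk.symm (hkS s hs) fun h => hx (h ▸ hs)
  have hQ : S ∪ {y | Linked G S x y} = insert x (G.neighborSet x) := by
    ext y
    constructor
    · rintro (hy | hy)
      · exact Or.inr (hxS y hy)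
      · exact hcomp y hy
    · rintro (rfl | hy)
      · exact Or.inr hxx
      · by_cases hyS : y ∈ S
        · exact Or.inl hyS
        · exact Or.inr (hxx.tail hyS hy)
  refine ⟨hQ ▸ (hsimp x hxx).isMaxClique, ⟨x, Or.inr hxx, hsimp x hxx⟩, ?_⟩
  obtain ⟨k, hk, hkS⟩ := hG.exists_linked_complete hS ha
  obtain ⟨Q', hsub, hQ'⟩ := exists_isMaxClique_ge
    ((hG.isClique hS).insert (a := k) fun s hs _ => hkS s hs)
  have hkQ' : k ∈ Q' := hsub (Or.inl rfl)
  have hdis : ∀ y ∈ Q', ¬ Linked G S x y := fun y hy hxy => hax <|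
    (hk.trans (Linked.of_isClique hQ'.1 hkQ' hy hk.right_notMem hxy.right_notMem)).trans hxy.symm
  refine ⟨Q', hQ', fun h => hdis x (h ▸ Or.inr hxx) hxx, ?_⟩
  ext y
  constructor
  · rintro ⟨hy, hyQ'⟩
    exact ⟨hy, hS.not_isSimplicial (hy.resolve_right (hdis y hyQ'))⟩
  · rintro ⟨hy, hns⟩
    exact ⟨hy, hsub (Or.inr (hy.resolve_right fun h => hns (hsimp y h)))⟩

/-- A simplicial vertex of a boundary clique `Q ⊇ S` does not lie in a component of `G - S`
that contains another minimal vertex separator. -/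
theorem not_linked_of_mem_isBoundaryClique [Finite V] (hG : StrictlyChordal G) {S' Q : Set V}
    (hS : IsMVS G S) (hS' : IsMVS G S') (hne : S ≠ S') (hQ : IsBoundaryClique G Q)
    (hSQ : S ⊆ Q) (hxQ : x ∈ Q) (hx : IsSimplicial G x) (hy : y ∈ S') : ¬ Linked G S x y := by
  intro hxy
  obtain ⟨hQm, -, Q', hQ'm, hQQ', hinter⟩ := hQ
  have hmem : ∀ r ∈ Q, ¬ IsSimplicial G r → r ∈ Q' := fun r hr hns =>
    (hinter.superset ⟨hr, hns⟩ : r ∈ Q ∩ Q').2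
  obtain ⟨w, hwQ', hwQ⟩ : ∃ w ∈ Q', w ∉ Q := by
    by_contra! hcon
    exact hQQ' (hQ'm.2 Q hQm.1 hcon)
  have hxw : x ≠ w := fun h => hwQ (h ▸ hxQ)
  have hadj : ¬ G.Adj x w := fun h => hwQ (by
    rw [hQm.eq_insert_neighborSet hxQ hx]
    exact Or.inr h)
  obtain ⟨T, hT, hsep⟩ := exists_isMVS_of_not_adj hxw hadj
  have hTr : ∀ r ∈ Q, ¬ IsSimplicial G r → r ∈ T := by
    intro r hr hns
    refine hsep.mem_of_adj_adj (hQm.1 hxQ hr ?_) (hQ'm.1 hwQ' (hmem r hr hns) ?_)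
    · rintro rfl
      exact hns hx
    · rintro rfl
      exact hwQ hr
  obtain ⟨s, hs⟩ := hS.nonempty hG.1
  have hST := hG.eq_of_mem hS hT hs (hTr s (hSQ hs) (hS.not_isSimplicial hs))
  subst hST
  have hyQ : y ∈ Q := by
    refine hxy.induct hxQ fun b c hb hbQ hbc _ => ?_
    have hbs : IsSimplicial G b := by
      by_contra hns
      exact hb.right_notMem (hTr b hbQ hns)
    rw [hQm.eq_insert_neighborSet hbQ hbs]
    exact Or.inr hbc
  exact hne (hG.eq_of_mem hS hS' (hTr y hyQ (hS'.not_isSimplicial hy)) hy)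

end StrictlyChordal

theorem setOf_exists_connectedComponentMk_eq (hx : x ∈ Sᶜ) :
    {y | ∃ h : y ∈ Sᶜ, (G.induce Sᶜ).connectedComponentMk ⟨y, h⟩ =
      (G.induce Sᶜ).connectedComponentMk ⟨x, hx⟩} = {y | Linked G S x y} := by
  ext y
  constructor
  · rintro ⟨h, e⟩
    exact ⟨hx, h, (ConnectedComponent.exact e).symm⟩
  · rintro ⟨_, h, e⟩
    exact ⟨h, ConnectedComponent.sound e.symm⟩

end

theorem statement8 {V : Type*} [Finite V] (G : SimpleGraph V)
    (hsc : StrictlyChordal G)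
    (h2 : ∃ S S' : Set V, IsMVS G S ∧ IsMVS G S' ∧ S ≠ S') :
    ∃ S : Set V, IsMVS G S ∧ Nat.card (BS G S) + 1 = numComp G S := by
  classical
  obtain ⟨S, a, S', hS, hS', hne, ha, hT⟩ := hsc.exists_leaf h2
  refine ⟨S, hS, ?_⟩
  obtain ⟨t, ht⟩ := hS'.nonempty hsc.1
  have hat : Linked G S a t := hT S' hS' hne.symm t ht
  let K := (G.induce Sᶜ).connectedComponentMk ⟨a, ha⟩
  let B : (G.induce Sᶜ).ConnectedComponent → Set V := fun c =>
    {y | ∃ h : y ∈ Sᶜ, (G.induce Sᶜ).connectedComponentMk ⟨y, h⟩ = c}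
  have hB : ∀ c, c ≠ K → S ∪ B c ∈ BS G S := by
    intro c hc
    induction c using ConnectedComponent.ind with | _ x =>
    refine ⟨?_, Set.subset_union_left⟩
    have hax : ¬ Linked G S a x := fun ⟨_, _, h⟩ => hc (ConnectedComponent.sound h.symm)
    have := hsc.isBoundaryClique_union hS ha hT x.2 hax
    rwa [← setOf_exists_connectedComponentMk_eq x.2] at this
  have hbij : Function.Bijective
      (fun c : {c // c ≠ K} => (⟨S ∪ B c, hB c c.2⟩ : BS G S)) := by
    constructor
    · rintro ⟨c, hc⟩ ⟨d, hd⟩ hcd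
      have hcd' : S ∪ B c = S ∪ B d := congrArg Subtype.val hcd
      induction c using ConnectedComponent.ind with | _ x =>
      have hx : (x : V) ∈ S ∪ B d := hcd' ▸ Or.inr ⟨x.2, rfl⟩
      obtain ⟨_, h⟩ := hx.resolve_left x.2
      exact Subtype.ext h
    · rintro ⟨Q, hQ, hSQ⟩
      obtain ⟨x, hxQ, hx⟩ := hQ.2.1
      have hxS : x ∉ S := fun h => hS.not_isSimplicial h hx
      have hax : ¬ Linked G S a x := fun h =>
        hsc.not_linked_of_mem_isBoundaryClique hS hS' hne hQ hSQ hxQ hx ht (h.symm.trans hat)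
      refine ⟨⟨(G.induce Sᶜ).connectedComponentMk ⟨x, hxS⟩, fun h =>
        hax ⟨ha, hxS, (ConnectedComponent.exact h).symm⟩⟩, Subtype.ext ?_⟩
      have h1 := hsc.isBoundaryClique_union hS ha hT hxS hax
      have h2 := setOf_exists_connectedComponentMk_eq (G := G) (x := x) hxS
      change S ∪ {y | _} = Q
      rw [h2, hQ.1.eq_insert_neighborSet hxQ hx]
      exact h1.1.eq_insert_neighborSet (Or.inr (Linked.refl hxS)) hx
  rw [← Nat.card_congr (Equiv.ofBijective _ hbij), numComp, ← Finite.card_option]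
  exact Nat.card_congr (Equiv.optionSubtypeNe K)
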